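/- arXiv:1903.11742 — 2 statements merged into one kernel-verified Lean document; each statement's English description precedes it below -/
import Mathlib

section
/- Comparison principle: Let u̲ be a subsolution and ū be a supersolution of problem (P) in Q_T. Suppose additionally that u̲(x,t) > 0 or ū(x,t) > 0 in Q_T ∪ Γ_T in the case min(r,p,l) < 1. Then ū(x,t) ≥ u̲(x,t) everywhere in Q_T ∪ Γ_T. -/
open Set MeasureTheory Real Filter

noncomputable section

/-- The Laplacian of `f : ℝⁿ → ℝ`, written as the sum of second directional
derivatives along the coordinate directions. -/
def lap {n : ℕ} (f : EuclideanSpace ℝ (Fin n) → ℝ) (x : EuclideanSpace ℝ (Fin n)) : ℝ :=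
  ∑ i : Fin n,
    fderiv ℝ (fun y => fderiv ℝ f y (EuclideanSpace.single i 1)) x (EuclideanSpace.single i 1)

/-- Local Hölder continuity on `closure Ω × [0,∞)` (with exponent `α ∈ (0,1)`). -/
def LocHolder {n : ℕ} (Ω : Set (EuclideanSpace ℝ (Fin n)))
    (f : EuclideanSpace ℝ (Fin n) → ℝ → ℝ) : Prop :=
  ∃ α : ℝ, 0 < α ∧ α < 1 ∧ ∀ M : ℝ, 0 < M → ∃ C : ℝ,
    ∀ x ∈ closure Ω, ∀ y ∈ closure Ω, ∀ s ∈ Icc (0:ℝ) M, ∀ t ∈ Icc (0:ℝ) M,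
      |f x s - f y t| ≤ C * (dist x y + |s - t|) ^ α

/-- Structural hypotheses on the domain `Ω` and the coefficients `a`, `b`, `k`
of problem (P): `Ω` is a nonempty bounded open set, `a, b` are nonnegative and locally
Hölder continuous on `closure Ω × [0,∞)`, and `k` is nonnegative and continuous on
`∂Ω × closure Ω × [0,∞)`. -/
def GoodData {n : ℕ} (Ω : Set (EuclideanSpace ℝ (Fin n)))
    (a b : EuclideanSpace ℝ (Fin n) → ℝ → ℝ)
    (k : EuclideanSpace ℝ (Fin n) → EuclideanSpace ℝ (Fin n) → ℝ → ℝ) : Prop :=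
  IsOpen Ω ∧ Bornology.IsBounded Ω ∧ Ω.Nonempty ∧
  LocHolder Ω a ∧ LocHolder Ω b ∧
  (∀ x ∈ closure Ω, ∀ t : ℝ, 0 ≤ t → 0 ≤ a x t ∧ 0 ≤ b x t) ∧
  ContinuousOn (fun z : (EuclideanSpace ℝ (Fin n) × EuclideanSpace ℝ (Fin n)) × ℝ =>
      k z.1.1 z.1.2 z.2) ((frontier Ω ×ˢ closure Ω) ×ˢ Ici 0) ∧
  (∀ x ∈ frontier Ω, ∀ y ∈ closure Ω, ∀ t : ℝ, 0 ≤ t → 0 ≤ k x y t)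

/-- Admissible initial datum for problem (P): nonnegative, continuous on `closure Ω`,
and compatible with the nonlocal boundary condition at `t = 0`. -/
def GoodInit {n : ℕ} (Ω : Set (EuclideanSpace ℝ (Fin n)))
    (k : EuclideanSpace ℝ (Fin n) → EuclideanSpace ℝ (Fin n) → ℝ → ℝ) (l : ℝ)
    (u0 : EuclideanSpace ℝ (Fin n) → ℝ) : Prop :=
  ContinuousOn u0 (closure Ω) ∧ (∀ x ∈ closure Ω, 0 ≤ u0 x) ∧
  ∀ x ∈ frontier Ω, u0 x = ∫ y in Ω, k x y 0 * u0 y ^ l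

/-- Regularity required of sub/supersolutions in `Q_T`: continuity on
`Q_T ∪ Γ_T = closure Ω × [0,T)`, `C²` in space and differentiability in time inside `Q_T`. -/
def RegQ {n : ℕ} (Ω : Set (EuclideanSpace ℝ (Fin n))) (T : ℝ)
    (u : EuclideanSpace ℝ (Fin n) → ℝ → ℝ) : Prop :=
  ContinuousOn (fun z : EuclideanSpace ℝ (Fin n) × ℝ => u z.1 z.2) (closure Ω ×ˢ Ico 0 T) ∧
  (∀ t ∈ Ioo (0:ℝ) T, ContDiffOn ℝ 2 (fun x => u x t) Ω) ∧
  (∀ x ∈ Ω, ∀ t ∈ Ioo (0:ℝ) T, DifferentiableAt ℝ (u x) t)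

/-- `u` is a supersolution of problem (P) in `Q_T`. -/
def IsSuperSol {n : ℕ} (r p q l : ℝ) (Ω : Set (EuclideanSpace ℝ (Fin n)))
    (a b : EuclideanSpace ℝ (Fin n) → ℝ → ℝ)
    (k : EuclideanSpace ℝ (Fin n) → EuclideanSpace ℝ (Fin n) → ℝ → ℝ)
    (u0 : EuclideanSpace ℝ (Fin n) → ℝ) (T : ℝ)
    (u : EuclideanSpace ℝ (Fin n) → ℝ → ℝ) : Prop :=
  RegQ Ω T u ∧ (∀ x ∈ closure Ω, ∀ t ∈ Ico (0:ℝ) T, 0 ≤ u x t) ∧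
  (∀ x ∈ Ω, ∀ t ∈ Ioo (0:ℝ) T,
    deriv (u x) t ≥ lap (fun y => u y t) x
      + a x t * u x t ^ r * (∫ y in Ω, u y t ^ p) - b x t * u x t ^ q) ∧
  (∀ x ∈ frontier Ω, ∀ t ∈ Ioo (0:ℝ) T, u x t ≥ ∫ y in Ω, k x y t * u y t ^ l) ∧
  (∀ x ∈ Ω, u x 0 ≥ u0 x)

/-- `u` is a subsolution of problem (P) in `Q_T`. -/
def IsSubSol {n : ℕ} (r p q l : ℝ) (Ω : Set (EuclideanSpace ℝ (Fin n)))
    (a b : EuclideanSpace ℝ (Fin n) → ℝ → ℝ)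
    (k : EuclideanSpace ℝ (Fin n) → EuclideanSpace ℝ (Fin n) → ℝ → ℝ)
    (u0 : EuclideanSpace ℝ (Fin n) → ℝ) (T : ℝ)
    (u : EuclideanSpace ℝ (Fin n) → ℝ → ℝ) : Prop :=
  RegQ Ω T u ∧ (∀ x ∈ closure Ω, ∀ t ∈ Ico (0:ℝ) T, 0 ≤ u x t) ∧
  (∀ x ∈ Ω, ∀ t ∈ Ioo (0:ℝ) T,
    deriv (u x) t ≤ lap (fun y => u y t) x
      + a x t * u x t ^ r * (∫ y in Ω, u y t ^ p) - b x t * u x t ^ q) ∧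
  (∀ x ∈ frontier Ω, ∀ t ∈ Ioo (0:ℝ) T, u x t ≤ ∫ y in Ω, k x y t * u y t ^ l) ∧
  (∀ x ∈ Ω, u x 0 ≤ u0 x)

/-- `u` is a solution of problem (P) in `Q_T`: both a subsolution and a supersolution. -/
def IsSol {n : ℕ} (r p q l : ℝ) (Ω : Set (EuclideanSpace ℝ (Fin n)))
    (a b : EuclideanSpace ℝ (Fin n) → ℝ → ℝ)
    (k : EuclideanSpace ℝ (Fin n) → EuclideanSpace ℝ (Fin n) → ℝ → ℝ)
    (u0 : EuclideanSpace ℝ (Fin n) → ℝ) (T : ℝ)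
    (u : EuclideanSpace ℝ (Fin n) → ℝ → ℝ) : Prop :=
  IsSubSol r p q l Ω a b k u0 T u ∧ IsSuperSol r p q l Ω a b k u0 T u

/-- `u` solves problem (P) in `Q_T` for every `T < Tstar`. -/
def IsSolOn {n : ℕ} (r p q l : ℝ) (Ω : Set (EuclideanSpace ℝ (Fin n)))
    (a b : EuclideanSpace ℝ (Fin n) → ℝ → ℝ)
    (k : EuclideanSpace ℝ (Fin n) → EuclideanSpace ℝ (Fin n) → ℝ → ℝ)
    (u0 : EuclideanSpace ℝ (Fin n) → ℝ) (Tstar : ℝ)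
    (u : EuclideanSpace ℝ (Fin n) → ℝ → ℝ) : Prop :=
  ∀ T : ℝ, 0 < T → T < Tstar → IsSol r p q l Ω a b k u0 T u

/-- `sup_Ω u(·,t) → ∞` as `t → Tstar⁻`. -/
def BlowsUpAt {n : ℕ} (Ω : Set (EuclideanSpace ℝ (Fin n)))
    (u : EuclideanSpace ℝ (Fin n) → ℝ → ℝ) (Tstar : ℝ) : Prop :=
  ∀ M : ℝ, ∀ᶠ t in nhdsWithin Tstar (Iio Tstar), ∃ x ∈ Ω, M < u x t

/-- Every nontrivial solution with initial datum `u0` blows up in finite time: there is no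
global solution, and every noncontinuable solution on a maximal time interval `[0, Tstar)`
satisfies `sup_Ω u(·,t) → ∞` as `t → Tstar⁻`. -/
def AllSolutionsBlowUp {n : ℕ} (r p q l : ℝ) (Ω : Set (EuclideanSpace ℝ (Fin n)))
    (a b : EuclideanSpace ℝ (Fin n) → ℝ → ℝ)
    (k : EuclideanSpace ℝ (Fin n) → EuclideanSpace ℝ (Fin n) → ℝ → ℝ)
    (u0 : EuclideanSpace ℝ (Fin n) → ℝ) : Prop :=
  (∀ u : EuclideanSpace ℝ (Fin n) → ℝ → ℝ, ¬ (∀ T : ℝ, 0 < T → IsSol r p q l Ω a b k u0 T u)) ∧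
  (∀ (u : EuclideanSpace ℝ (Fin n) → ℝ → ℝ) (Tstar : ℝ), 0 < Tstar →
    IsSolOn r p q l Ω a b k u0 Tstar u →
    (¬ ∃ (v : EuclideanSpace ℝ (Fin n) → ℝ → ℝ) (T' : ℝ), Tstar < T' ∧
        IsSolOn r p q l Ω a b k u0 T' v ∧
        ∀ x ∈ closure Ω, ∀ t ∈ Ico (0:ℝ) Tstar, v x t = u x t) →
    BlowsUpAt Ω u Tstar)

/-- `φ` is a (positive, hence principal) Dirichlet eigenfunction of `-Δ` on `Ω` with
eigenvalue `lam`:  `Δφ + lam φ = 0` in `Ω`, `φ = 0` on `∂Ω`, `φ > 0` in `Ω`. -/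
def IsDirichletEigen {n : ℕ} (Ω : Set (EuclideanSpace ℝ (Fin n))) (lam : ℝ)
    (φ : EuclideanSpace ℝ (Fin n) → ℝ) : Prop :=
  ContinuousOn φ (closure Ω) ∧ ContDiffOn ℝ 2 φ Ω ∧
  (∀ x ∈ Ω, lap φ x + lam * φ x = 0) ∧ (∀ x ∈ frontier Ω, φ x = 0) ∧ (∀ x ∈ Ω, 0 < φ x)

/-- `lam` is the first Dirichlet eigenvalue of `-Δ` on `Ω`, with (some) positive
eigenfunction `φ`. -/
def IsFirstEigen {n : ℕ} (Ω : Set (EuclideanSpace ℝ (Fin n))) (lam : ℝ)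
    (φ : EuclideanSpace ℝ (Fin n) → ℝ) : Prop :=
  IsDirichletEigen Ω lam φ ∧
  ∀ lam' : ℝ, (∃ ψ : EuclideanSpace ℝ (Fin n) → ℝ, ContinuousOn ψ (closure Ω) ∧
      ContDiffOn ℝ 2 ψ Ω ∧ (∀ x ∈ Ω, lap ψ x + lam' * ψ x = 0) ∧
      (∀ x ∈ frontier Ω, ψ x = 0) ∧ ∃ x ∈ Ω, ψ x ≠ 0) → lam ≤ lam'

/-- `sup_Ω f(·,t)`. -/
def supOmega {n : ℕ} (Ω : Set (EuclideanSpace ℝ (Fin n)))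
    (f : EuclideanSpace ℝ (Fin n) → ℝ → ℝ) (t : ℝ) : ℝ :=
  sSup ((fun x => f x t) '' Ω)

/-- `inf_Ω f(·,t)`. -/
def infOmega {n : ℕ} (Ω : Set (EuclideanSpace ℝ (Fin n)))
    (f : EuclideanSpace ℝ (Fin n) → ℝ → ℝ) (t : ℝ) : ℝ :=
  sInf ((fun x => f x t) '' Ω)

/-- `inf_{∂Ω × Ω} k(·,·,t)`. -/
def infBdry {n : ℕ} (Ω : Set (EuclideanSpace ℝ (Fin n)))
    (k : EuclideanSpace ℝ (Fin n) → EuclideanSpace ℝ (Fin n) → ℝ → ℝ) (t : ℝ) : ℝ :=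
  sInf ((fun z : EuclideanSpace ℝ (Fin n) × EuclideanSpace ℝ (Fin n) => k z.1 z.2 t) ''
    (frontier Ω ×ˢ Ω))

open scoped Manifold ContDiff Topology

/-- For an exponent `e ≥ 1`, the power function is Lipschitz on `[0, M]`. -/
lemma rpow_sub_rpow_le_of_one_le {e s t M : ℝ} (he : 1 ≤ e) (ht : 0 ≤ t) (hts : t ≤ s)
    (hM : s ≤ M) : s ^ e - t ^ e ≤ e * M ^ (e - 1) * (s - t) := by
  have hd : ∀ x : ℝ, HasDerivAt (fun x : ℝ => x ^ e) (e * x ^ (e - 1)) x :=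
    fun x => Real.hasDerivAt_rpow_const (Or.inr he)
  refine (convex_Icc (0 : ℝ) M).image_sub_le_mul_sub_of_deriv_le (f := fun x : ℝ => x ^ e)
    (fun x _ => (hd x).continuousAt.continuousWithinAt)
    (fun x _ => (hd x).differentiableAt.differentiableWithinAt) ?_ t ⟨ht, hts.trans hM⟩ s
    ⟨ht.trans hts, hM⟩ hts
  intro x hx
  rw [interior_Icc] at hx
  rw [(hd x).deriv]
  have := Real.rpow_le_rpow hx.1.le hx.2.le (sub_nonneg.2 he)
  gcongr

/-- For an exponent `e < 1`, differences of powers are controlled linearly as soon as the larger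
argument stays away from zero. -/
lemma rpow_sub_rpow_le_of_lt_one {e s t m : ℝ} (he : e < 1) (ht : 0 ≤ t) (hts : t ≤ s)
    (hm : 0 < m) (hms : m ≤ s) (he0 : 0 < e) : s ^ e - t ^ e ≤ m ^ (e - 1) * (s - t) := by
  have hs : 0 < s := hm.trans_le hms
  have h1 : s ^ e = s ^ (e - 1) * s := by
    rw [← Real.rpow_add_one hs.ne', sub_add_cancel]
  have h2 : s ^ (e - 1) * t ≤ t ^ e := by
    rcases ht.eq_or_lt with rfl | ht
    · simp [Real.zero_rpow he0.ne']
    · have : t ^ e = t ^ (e - 1) * t := by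
        rw [← Real.rpow_add_one ht.ne', sub_add_cancel]
      rw [this]
      exact mul_le_mul_of_nonneg_right
        (Real.rpow_le_rpow_of_nonpos ht hts (by linarith)) ht.le
  have h3 : s ^ (e - 1) ≤ m ^ (e - 1) :=
    Real.rpow_le_rpow_of_nonpos hm hms (by linarith)
  have h4 := mul_le_mul_of_nonneg_right h3 (sub_nonneg.2 hts)
  rw [h1]
  linarith

/-- One-sided Lipschitz bound for `s ↦ s ^ e` along two nonnegative bounded functions. -/
lemma exists_rpow_sub_rpow_le_mul_max {α : Type*} {S : Set α} {u v : α → ℝ} {e M : ℝ}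
    (he : 0 < e) (hv : ∀ z ∈ S, 0 ≤ v z) (hM0 : 0 ≤ M) (hM : ∀ z ∈ S, u z ≤ M)
    (hlow : e < 1 → ∃ m > 0, ∀ z ∈ S, v z < u z → m ≤ u z) :
    ∃ L, 0 ≤ L ∧ ∀ z ∈ S, 0 ≤ u z → u z ^ e - v z ^ e ≤ L * max (u z - v z) 0 := by
  have key : ∃ L, 0 ≤ L ∧ ∀ z ∈ S, v z < u z → u z ^ e - v z ^ e ≤ L * (u z - v z) := by
    rcases lt_or_ge e 1 with h | h
    · obtain ⟨m, hm, hmu⟩ := hlow h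
      exact ⟨m ^ (e - 1), by positivity, fun z hz huv =>
        rpow_sub_rpow_le_of_lt_one h (hv z hz) huv.le hm (hmu z hz huv) he⟩
    · exact ⟨e * M ^ (e - 1), by positivity, fun z hz huv =>
        rpow_sub_rpow_le_of_one_le h (hv z hz) huv.le (hM z hz)⟩
  obtain ⟨L, hL, h⟩ := key
  refine ⟨L, hL, fun z hz hu => ?_⟩
  rcases lt_or_ge (v z) (u z) with huv | huv
  · rw [max_eq_left (by linarith)]
    exact h z hz huv
  · rw [max_eq_right (by linarith), mul_zero, sub_nonpos]
    exact Real.rpow_le_rpow hu huv he.le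

/-- The derivative of a `C²` function in a fixed direction is differentiable. -/
lemma ContDiffAt.differentiableAt_fderiv_apply {E : Type*} [NormedAddCommGroup E]
    [NormedSpace ℝ E] {f : E → ℝ} {x : E} (hf : ContDiffAt ℝ 2 f x) (v : E) :
    DifferentiableAt ℝ (fun y => fderiv ℝ f y v) x :=
  ((hf.fderiv_right (m := 1) (by norm_num)).differentiableAt one_ne_zero).clm_apply
    (differentiableAt_const v)

/-- At a local maximum, second directional derivatives of a `C²` function are nonpositive. -/
lemma fderiv_fderiv_nonpos_of_isLocalMax {E : Type*} [NormedAddCommGroup E]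
    [NormedSpace ℝ E] {f : E → ℝ} {x : E} (hf : ContDiffAt ℝ 2 f x) (h : IsLocalMax f x) (v : E) :
    fderiv ℝ (fun y => fderiv ℝ f y v) x v ≤ 0 := by
  by_contra! hpos
  set c : ℝ → E := fun s => x + s • v with hc
  have hc0 : c 0 = x := by simp [hc]
  have hcd : ∀ s, HasDerivAt c v s := fun s => by
    have := ((hasDerivAt_id s).smul_const v).const_add x
    rwa [one_smul] at this
  have hct : Tendsto c (𝓝 0) (𝓝 x) := by
    simpa [hc0] using (hcd 0).continuousAt.tendsto
  have hev : ∀ᶠ y in 𝓝 x, DifferentiableAt ℝ f y := by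
    filter_upwards [hf.eventually (by simp)] with y hy
    exact hy.differentiableAt two_ne_zero
  have hd1 : deriv (f ∘ c) =ᶠ[𝓝 0] fun s => fderiv ℝ f (c s) v := by
    filter_upwards [hct.eventually hev] with s hs
    exact (hs.hasFDerivAt.comp_hasDerivAt s (hcd s)).deriv
  have hd2 : deriv (deriv (f ∘ c)) 0 = fderiv ℝ (fun y => fderiv ℝ f y v) x v := by
    rw [hd1.deriv_eq]
    have h2 := hf.differentiableAt_fderiv_apply v
    rw [← hc0] at h2
    have := (h2.hasFDerivAt.comp_hasDerivAt 0 (hcd 0)).deriv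
    rw [hc0] at this
    exact this
  have hmax : IsLocalMax (f ∘ c) 0 := by
    have := hct.eventually h
    simpa [IsLocalMax, IsMaxFilter, hc0] using this
  have hcont : ContinuousAt (f ∘ c) 0 := by
    refine ContinuousAt.comp ?_ (hcd 0).continuousAt
    rw [hc0]
    exact hf.continuousAt
  have hmin : IsLocalMin (f ∘ c) 0 :=
    isLocalMin_of_deriv_deriv_pos (by rw [hd2]; exact hpos) hmax.deriv_eq_zero hcont
  have hconst : f ∘ c =ᶠ[𝓝 0] fun _ => (f ∘ c) 0 := by
    filter_upwards [hmax, hmin] with s h1 h2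
    exact le_antisymm h1 h2
  have hzero : deriv (deriv (f ∘ c)) 0 = 0 := by
    rw [hconst.deriv.deriv_eq]
    simp
  linarith

/-- The Laplacian of a `C²` function is nonpositive at a local maximum. -/
lemma lap_nonpos_of_isLocalMax {n : ℕ} {f : EuclideanSpace ℝ (Fin n) → ℝ}
    {x : EuclideanSpace ℝ (Fin n)} (hf : ContDiffAt ℝ 2 f x) (h : IsLocalMax f x) :
    lap f x ≤ 0 :=
  Finset.sum_nonpos fun _ _ => fderiv_fderiv_nonpos_of_isLocalMax hf h _

lemma lap_sub {n : ℕ} {f g : EuclideanSpace ℝ (Fin n) → ℝ}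
    {x : EuclideanSpace ℝ (Fin n)} (hf : ContDiffAt ℝ 2 f x) (hg : ContDiffAt ℝ 2 g x) :
    lap (fun y => f y - g y) x = lap f x - lap g x := by
  unfold lap
  rw [← Finset.sum_sub_distrib]
  refine Finset.sum_congr rfl fun i _ => ?_
  have hev : (fun y => fderiv ℝ (fun z => f z - g z) y (EuclideanSpace.single i 1)) =ᶠ[𝓝 x]
      fun y => fderiv ℝ f y (EuclideanSpace.single i 1)
        - fderiv ℝ g y (EuclideanSpace.single i 1) := by
    filter_upwards [hf.eventually (by simp), hg.eventually (by simp)] with y h1 h2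
    rw [fderiv_fun_sub (h1.differentiableAt two_ne_zero) (h2.differentiableAt two_ne_zero)]
    rfl
  rw [hev.fderiv_eq, fderiv_fun_sub (hf.differentiableAt_fderiv_apply _)
    (hg.differentiableAt_fderiv_apply _)]
  rfl

lemma lap_const_mul {n : ℕ} {f : EuclideanSpace ℝ (Fin n) → ℝ}
    {x : EuclideanSpace ℝ (Fin n)} (hf : ContDiffAt ℝ 2 f x) (c : ℝ) :
    lap (fun y => c * f y) x = c * lap f x := by
  unfold lap
  rw [Finset.mul_sum]
  refine Finset.sum_congr rfl fun i _ => ?_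
  have hev : (fun y => fderiv ℝ (fun z => c * f z) y (EuclideanSpace.single i 1)) =ᶠ[𝓝 x]
      fun y => c * fderiv ℝ f y (EuclideanSpace.single i 1) := by
    filter_upwards [hf.eventually (by simp)] with y h1
    rw [fderiv_const_mul (h1.differentiableAt two_ne_zero)]
    rfl
  rw [hev.fderiv_eq, fderiv_const_mul (hf.differentiableAt_fderiv_apply _)]
  rfl

lemma continuous_lap {n : ℕ} {f : EuclideanSpace ℝ (Fin n) → ℝ} (hf : ContDiff ℝ 2 f) :
    Continuous (lap f) := by
  refine continuous_finsetSum _ fun i _ => ?_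
  have h1 : ContDiff ℝ 1 fun y => fderiv ℝ f y (EuclideanSpace.single i (1 : ℝ)) :=
    (hf.fderiv_right (m := 1) (by norm_num)).clm_apply contDiff_const
  exact (h1.continuous_fderiv one_ne_zero).clm_apply continuous_const

/-- A smooth positive weight that is at least `1` off `Ω` but has small integral over `Ω`. -/
lemma exists_boundary_layer_weight {n : ℕ} {Ω : Set (EuclideanSpace ℝ (Fin n))}
    (hΩ : IsOpen Ω) (hb : Bornology.IsBounded Ω) {η : ℝ} (hη : 0 < η) :
    ∃ (ψ : EuclideanSpace ℝ (Fin n) → ℝ) (δ : ℝ), ContDiff ℝ 2 ψ ∧ 0 < δ ∧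
      (∀ x, δ ≤ ψ x) ∧ (∀ x, ψ x ≤ 1 + δ) ∧ (∀ x ∉ Ω, 1 ≤ ψ x) ∧ ∫ y in Ω, ψ y < η := by
  have hfin : volume Ω ≠ ⊤ := hb.measure_lt_top.ne
  obtain ⟨K, hKΩ, hK, hKμ⟩ := hΩ.measurableSet.exists_isCompact_sdiff_lt hfin
    (ε := ENNReal.ofReal (η / 2)) (by simpa using hη)
  obtain ⟨χ, hχ0, hχ1, hχ⟩ := exists_contMDiffMap_zero_one_of_isClosed
    (n := 2) 𝓘(ℝ, EuclideanSpace ℝ (Fin n)) hΩ.isClosed_compl hK.isClosed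
    (disjoint_compl_left_iff_subset.2 hKΩ)
  have hχd : ContDiff ℝ 2 χ := χ.contMDiff.contDiff
  set V := volume.real Ω with hV
  have hV0 : 0 ≤ V := measureReal_nonneg
  set δ := η / (2 * (V + 1)) with hδ
  have hδ0 : 0 < δ := by positivity
  have hδV : δ * V < η / 2 := by
    rw [hδ, div_mul_eq_mul_div, div_lt_div_iff₀ (by positivity) (by positivity)]
    nlinarith
  refine ⟨fun x => 1 - χ x + δ, δ, (contDiff_const.sub hχd).add contDiff_const, hδ0,
    fun x => by linarith [(hχ x).2], fun x => by linarith [(hχ x).1], fun x hx => ?_, ?_⟩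
  · have : χ x = 0 := hχ0 hx
    simp only [this]
    linarith
  · have hχc : Continuous χ := hχd.continuous
    have hind : IntegrableOn (fun y => (Ω \ K).indicator (fun _ => (1 : ℝ)) y) Ω :=
      (integrableOn_const hfin).indicator (hΩ.measurableSet.diff hK.measurableSet)
    have hcst : IntegrableOn (fun _ : EuclideanSpace ℝ (Fin n) => δ) Ω := integrableOn_const hfin
    have hle : ∫ y in Ω, (1 - χ y + δ) ≤
        ∫ y in Ω, ((Ω \ K).indicator (fun _ => (1 : ℝ)) y + δ) := by
      refine setIntegral_mono_on ?_ (hind.add hcst) hΩ.measurableSet fun y hy => ?_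
      · refine (ContinuousOn.integrableOn_compact hb.isCompact_closure ?_).mono_set subset_closure
        exact ((continuous_const.sub hχc).add continuous_const).continuousOn
      · by_cases hyK : y ∈ K
        · have : χ y = 1 := hχ1 hyK
          simp [this, hyK]
        · rw [indicator_of_mem (show y ∈ Ω \ K from ⟨hy, hyK⟩)]
          linarith [(hχ y).1]
    have hmeas : volume.real (Ω \ K) ≤ η / 2 := by
      rw [measureReal_def]
      exact ENNReal.toReal_le_of_le_ofReal (by positivity) hKμ.le
    have heq : ∫ y in Ω, ((Ω \ K).indicator (fun _ => (1 : ℝ)) y + δ)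
        = volume.real (Ω \ K) + δ * V := by
      rw [integral_add hind hcst, setIntegral_indicator (hΩ.measurableSet.diff hK.measurableSet),
        setIntegral_const, setIntegral_const, inter_eq_right.2 sdiff_subset]
      simp [hV, mul_comm]
    linarith

/-- A first-touching-time principle: a function that is continuous on `K × [0, T]`, negative at
time `0` and nonnegative somewhere vanishes at some point before which it is nonpositive. -/
lemma exists_first_touching {X : Type*} [TopologicalSpace X] [T2Space X] {K : Set X}
    (hK : IsCompact K) {T : ℝ} {g : X → ℝ → ℝ}
    (hg : ContinuousOn (fun z : X × ℝ => g z.1 z.2) (K ×ˢ Icc 0 T))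
    (h0 : ∀ x ∈ K, g x 0 < 0) {x₁ : X} {t₁ : ℝ} (hx₁ : x₁ ∈ K) (ht₁ : t₁ ∈ Icc 0 T)
    (h₁ : 0 ≤ g x₁ t₁) :
    ∃ x₀ ∈ K, ∃ t₀ ∈ Ioc 0 T, g x₀ t₀ = 0 ∧ ∀ x ∈ K, ∀ t ∈ Icc 0 t₀, g x t ≤ 0 := by
  have hcpt : IsCompact (K ×ˢ Icc (0 : ℝ) T) := hK.prod isCompact_Icc
  have hS : IsCompact ((K ×ˢ Icc (0 : ℝ) T) ∩ (fun z : X × ℝ => g z.1 z.2) ⁻¹' Ici 0) :=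
    hcpt.of_isClosed_subset (hg.preimage_isClosed_of_isClosed hcpt.isClosed isClosed_Ici)
      inter_subset_left
  obtain ⟨⟨x₀, t₀⟩, ⟨⟨hx₀, ht₀⟩, hge⟩, hmin⟩ :=
    hS.exists_isMinOn ⟨(x₁, t₁), ⟨hx₁, ht₁⟩, h₁⟩ (f := Prod.snd) continuous_snd.continuousOn
  simp only at hx₀ ht₀
  have hge' : 0 ≤ g x₀ t₀ := hge
  have hpos : 0 < t₀ := by
    refine ht₀.1.lt_of_ne fun h => ?_
    rw [← h] at hge'
    exact absurd (h0 x₀ hx₀) (not_lt.2 hge')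
  have hlt : ∀ x ∈ K, ∀ t ∈ Ico 0 t₀, g x t < 0 := by
    intro x hx t ht
    by_contra! hc
    have : t₀ ≤ t := hmin (show (x, t) ∈ _ from ⟨⟨hx, ht.1, ht.2.le.trans ht₀.2⟩, hc⟩)
    exact absurd ht.2 (not_lt.2 this)
  have hle : ∀ x ∈ K, ∀ t ∈ Icc 0 t₀, g x t ≤ 0 := by
    intro x hx
    have hc : ContinuousOn (g x) (Icc 0 t₀) :=
      hg.comp (f := fun t => (x, t)) (by fun_prop)
        fun t ht => ⟨hx, ht.1, ht.2.trans ht₀.2⟩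
    have hcl : closure (Ico 0 t₀) = Icc 0 t₀ := closure_Ico hpos.ne
    rw [← hcl] at hc ⊢
    exact fun t ht => le_on_closure (fun s hs => (hlt x hx s hs).le) hc continuousOn_const ht
  exact ⟨x₀, hx₀, t₀, ⟨hpos, ht₀.2⟩, le_antisymm (hle _ hx₀ _ ⟨hpos.le, le_rfl⟩) hge', hle⟩

/-- The derivative at the right end point of an interval on which the function attains its
maximum there is nonnegative. -/
lemma deriv_nonneg_of_le_left {f : ℝ → ℝ} {t f' : ℝ} (hf : HasDerivAt f f' t) (ht : 0 < t)
    (h : ∀ s ∈ Icc 0 t, f s ≤ f t) : 0 ≤ f' := by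
  have hs := (hasDerivAt_iff_tendsto_slope_left_right.1 hf).1
  refine ge_of_tendsto hs ?_
  filter_upwards [Ioo_mem_nhdsLT ht] with s hs
  rw [slope_def_field]
  exact div_nonneg_of_nonpos (by linarith [h s ⟨hs.1.le, hs.2.le⟩]) (by linarith [hs.2])

/-- A locally Hölder function is bounded on `closure Ω × [0, T]`. -/
lemma LocHolder.exists_bound {n : ℕ} {Ω : Set (EuclideanSpace ℝ (Fin n))}
    {f : EuclideanSpace ℝ (Fin n) → ℝ → ℝ} (hf : LocHolder Ω f) (hb : Bornology.IsBounded Ω)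
    {T : ℝ} (hT : 0 < T) :
    ∃ A, 0 ≤ A ∧ ∀ x ∈ closure Ω, ∀ t ∈ Icc 0 T, f x t ≤ A := by
  rcases (closure Ω).eq_empty_or_nonempty with hemp | ⟨x₀, hx₀⟩
  · exact ⟨0, le_rfl, by simp [hemp]⟩
  obtain ⟨α, hα, -, h⟩ := hf
  obtain ⟨C, hC⟩ := h T hT
  set D := Metric.diam (closure Ω)
  have hD : 0 ≤ D := Metric.diam_nonneg
  refine ⟨|f x₀ 0| + |C| * (D + T) ^ α, by positivity, fun x hx t ht => ?_⟩
  have h1 := hC x hx x₀ hx₀ t ht 0 ⟨le_rfl, hT.le⟩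
  have h2 : (dist x x₀ + |t - 0|) ^ α ≤ (D + T) ^ α := by
    refine Real.rpow_le_rpow (by positivity) (add_le_add ?_ ?_) hα.le
    · exact Metric.dist_le_diam_of_mem hb.closure hx hx₀
    · rw [sub_zero, abs_of_nonneg ht.1]
      exact ht.2
  have h3 : C * (dist x x₀ + |t - 0|) ^ α ≤ |C| * (D + T) ^ α :=
    mul_le_mul (le_abs_self C) h2 (by positivity) (abs_nonneg C)
  have h4 := le_abs_self (f x t - f x₀ 0)
  have h5 := le_abs_self (f x₀ 0)
  linarith

/-- Strict parabolic maximum principle: a function that is negative initially, and for which a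
first zero can occur neither on the lateral boundary nor (by a strict differential inequality)
in the interior, stays negative. -/
lemma neg_of_strict_parabolic {n : ℕ} {Ω : Set (EuclideanSpace ℝ (Fin n))}
    (hΩ : IsOpen Ω) (hb : Bornology.IsBounded Ω) {T : ℝ}
    {g : EuclideanSpace ℝ (Fin n) → ℝ → ℝ}
    (hg : ContinuousOn (fun z : EuclideanSpace ℝ (Fin n) × ℝ => g z.1 z.2)
      (closure Ω ×ˢ Icc 0 T))
    (hspace : ∀ x ∈ Ω, ∀ t ∈ Ioc 0 T, ContDiffAt ℝ 2 (fun y => g y t) x)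
    (htime : ∀ x ∈ Ω, ∀ t ∈ Ioc 0 T, DifferentiableAt ℝ (g x) t)
    (h0 : ∀ x ∈ closure Ω, g x 0 < 0)
    (hint : ∀ x ∈ Ω, ∀ t ∈ Ioc 0 T, g x t = 0 → (∀ y ∈ closure Ω, g y t ≤ 0) →
      deriv (g x) t < lap (fun y => g y t) x)
    (hbdry : ∀ x ∈ frontier Ω, ∀ t ∈ Ioc 0 T, (∀ y ∈ closure Ω, g y t ≤ 0) → g x t ≠ 0) :
    ∀ x ∈ closure Ω, ∀ t ∈ Icc 0 T, g x t < 0 := by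
  intro x₁ hx₁ t₁ ht₁
  by_contra! h₁
  obtain ⟨x, hx, t, ht, hzero, hle⟩ :=
    exists_first_touching hb.isCompact_closure hg h0 hx₁ ht₁ h₁
  have hle' : ∀ y ∈ closure Ω, g y t ≤ 0 := fun y hy => hle y hy t ⟨ht.1.le, le_rfl⟩
  by_cases hxΩ : x ∈ Ω
  · have h2 : 0 ≤ deriv (g x) t := deriv_nonneg_of_le_left (htime x hxΩ t ht).hasDerivAt ht.1
      fun s hs => by rw [hzero]; exact hle x hx s hs
    have h3 : lap (fun y => g y t) x ≤ 0 := by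
      refine lap_nonpos_of_isLocalMax (hspace x hxΩ t ht) ?_
      filter_upwards [hΩ.mem_nhds hxΩ] with y hy
      rw [hzero]
      exact hle' y (subset_closure hy)
    linarith [hint x hxΩ t ht hzero hle']
  · refine hbdry x ?_ t ht hle' hzero
    rw [hΩ.frontier_eq]
    exact ⟨hx, hxΩ⟩

/-- Weighted integrals of powers inherit a one-sided Lipschitz bound from the integrand. -/
lemma setIntegral_mul_rpow_sub_le {n : ℕ} {Ω : Set (EuclideanSpace ℝ (Fin n))}
    (hΩ : IsOpen Ω) (hb : Bornology.IsBounded Ω) {c u v φ : EuclideanSpace ℝ (Fin n) → ℝ}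
    {e L C : ℝ} (he : 0 < e) (hL : 0 ≤ L)
    (hc : ContinuousOn c (closure Ω)) (hu : ContinuousOn u (closure Ω))
    (hv : ContinuousOn v (closure Ω)) (hφ : ContinuousOn φ (closure Ω))
    (hφ0 : ∀ y ∈ Ω, 0 ≤ φ y) (hc0 : ∀ y ∈ Ω, 0 ≤ c y) (hcC : ∀ y ∈ Ω, c y ≤ C)
    (hlip : ∀ y ∈ Ω, u y ^ e - v y ^ e ≤ L * max (u y - v y) 0)
    (huv : ∀ y ∈ Ω, u y - v y ≤ φ y) :
    (∫ y in Ω, c y * u y ^ e) - ∫ y in Ω, c y * v y ^ e ≤ C * L * ∫ y in Ω, φ y := by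
  have hint : ∀ {f : EuclideanSpace ℝ (Fin n) → ℝ}, ContinuousOn f (closure Ω) →
      IntegrableOn f Ω := fun hf =>
    (hf.integrableOn_compact hb.isCompact_closure).mono_set subset_closure
  have hu' : IntegrableOn (fun y => c y * u y ^ e) Ω :=
    hint (hc.mul (hu.rpow_const fun _ _ => Or.inr he.le))
  have hv' : IntegrableOn (fun y => c y * v y ^ e) Ω :=
    hint (hc.mul (hv.rpow_const fun _ _ => Or.inr he.le))
  rw [← integral_sub hu' hv', ← integral_const_mul]
  refine setIntegral_mono_on (hu'.sub hv') ((hint hφ).const_mul _) hΩ.measurableSet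
    fun y hy => ?_
  have h1 : max (u y - v y) 0 ≤ φ y := max_le (huv y hy) (hφ0 y hy)
  have h2 := hlip y hy
  have h3 : u y ^ e - v y ^ e ≤ L * φ y := h2.trans (mul_le_mul_of_nonneg_left h1 hL)
  have h4 := mul_le_mul_of_nonneg_left h3 (hc0 y hy)
  have h5 := mul_le_mul_of_nonneg_right (hcC y hy) (mul_nonneg hL (hφ0 y hy))
  linarith

/-- **Comparison principle.** If `u₁` is a subsolution and `u₂` a supersolution of
problem (P) in `Q_T`, and in the case `min(r,p,l) < 1` one of them is positive on
`Q_T ∪ Γ_T = closure Ω × [0,T)`, then `u₂ ≥ u₁` on `Q_T ∪ Γ_T`. -/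
theorem comparison_principle {n : ℕ} (r p q l : ℝ)
    (hr : 0 < r) (hp : 0 < p) (hq : 0 < q) (hl : 0 < l)
    (Ω : Set (EuclideanSpace ℝ (Fin n)))
    (a b : EuclideanSpace ℝ (Fin n) → ℝ → ℝ)
    (k : EuclideanSpace ℝ (Fin n) → EuclideanSpace ℝ (Fin n) → ℝ → ℝ)
    (hdata : GoodData Ω a b k)
    (u0 : EuclideanSpace ℝ (Fin n) → ℝ) (hinit : GoodInit Ω k l u0)
    (T : ℝ) (hT : 0 < T)
    (u₁ u₂ : EuclideanSpace ℝ (Fin n) → ℝ → ℝ)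
    (hsub : IsSubSol r p q l Ω a b k u0 T u₁)
    (hsup : IsSuperSol r p q l Ω a b k u0 T u₂)
    (hpos : min r (min p l) < 1 →
      (∀ x ∈ closure Ω, ∀ t ∈ Ico (0:ℝ) T, 0 < u₁ x t) ∨
      (∀ x ∈ closure Ω, ∀ t ∈ Ico (0:ℝ) T, 0 < u₂ x t)) :
    ∀ x ∈ closure Ω, ∀ t ∈ Ico (0:ℝ) T, u₁ x t ≤ u₂ x t := by
  obtain ⟨hΩ, hb, -, ha, -, hab, hk, hk0⟩ := hdata
  obtain ⟨⟨hc₁, hC₁, hd₁⟩, hn₁, hpde₁, hbc₁, hi₁⟩ := hsub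
  obtain ⟨⟨hc₂, hC₂, hd₂⟩, hn₂, hpde₂, hbc₂, hi₂⟩ := hsup
  intro x₁ hx₁ t₁ ht₁
  obtain ⟨T', hT₁, hT'⟩ := exists_between ht₁.2
  have hT'0 : 0 < T' := ht₁.1.trans_lt hT₁
  have hIcc : Icc 0 T' ⊆ Ico 0 T := fun t ht => ⟨ht.1, ht.2.trans_lt hT'⟩
  have hIoc : Ioc 0 T' ⊆ Ioo 0 T := fun t ht => ⟨ht.1, ht.2.trans_lt hT'⟩
  set S : Set (EuclideanSpace ℝ (Fin n) × ℝ) := closure Ω ×ˢ Icc 0 T' with hSdef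
  have hS : IsCompact S := hb.isCompact_closure.prod isCompact_Icc
  have hSsub : S ⊆ closure Ω ×ˢ Ico 0 T := prod_mono_right hIcc
  have hcS₁ := hc₁.mono hSsub
  have hcS₂ := hc₂.mono hSsub
  have hslice : ∀ {u : EuclideanSpace ℝ (Fin n) → ℝ → ℝ},
      ContinuousOn (fun z : EuclideanSpace ℝ (Fin n) × ℝ => u z.1 z.2) S →
      ∀ t ∈ Icc 0 T', ContinuousOn (fun y => u y t) (closure Ω) := fun hu t ht =>
    hu.comp (f := fun y => (y, t)) (by fun_prop) fun y hy => ⟨hy, ht⟩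
  -- initial ordering on the closure
  have hinit0 : ∀ x ∈ closure Ω, u₁ x 0 ≤ u₂ x 0 := by
    intro x hx
    have h0 : (0 : ℝ) ∈ Icc 0 T' := ⟨le_rfl, hT'0.le⟩
    exact le_on_closure (fun y hy => (hi₁ y hy).trans (hi₂ y hy)) (hslice hcS₁ 0 h0)
      (hslice hcS₂ 0 h0) hx
  -- uniform bounds
  obtain ⟨M₁, hM₁⟩ := (hS.image_of_continuousOn hcS₁).bddAbove
  obtain ⟨M₂, hM₂⟩ := (hS.image_of_continuousOn hcS₂).bddAbove
  set M := max (max M₁ M₂) 0 with hMdef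
  have hM0 : 0 ≤ M := le_max_right _ _
  have hu₁M : ∀ z ∈ S, u₁ z.1 z.2 ≤ M := fun z hz =>
    (hM₁ (mem_image_of_mem _ hz)).trans ((le_max_left _ _).trans (le_max_left _ _))
  have hu₂M : ∀ z ∈ S, u₂ z.1 z.2 ≤ M := fun z hz =>
    (hM₂ (mem_image_of_mem _ hz)).trans ((le_max_right _ _).trans (le_max_left _ _))
  obtain ⟨A, hA0, hA⟩ := ha.exists_bound hb hT'0
  have hfr : IsCompact (frontier Ω) :=
    hb.isCompact_closure.of_isClosed_subset isClosed_frontier frontier_subset_closure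
  obtain ⟨K', hK'⟩ := ((((hfr.prod hb.isCompact_closure).prod
    (isCompact_Icc (a := (0 : ℝ)) (b := T')))).image_of_continuousOn
      (hk.mono (prod_mono_right Icc_subset_Ici_self))).bddAbove
  set K := max K' 0 with hKdef
  have hK0 : 0 ≤ K := le_max_right _ _
  have hkK : ∀ x ∈ frontier Ω, ∀ y ∈ closure Ω, ∀ t ∈ Icc 0 T', k x y t ≤ K :=
    fun x hx y hy t ht => (hK' (mem_image_of_mem _ (show ((x, y), t) ∈ _ from
      ⟨⟨hx, hy⟩, ht⟩))).trans (le_max_left _ _)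
  -- one-sided Lipschitz bounds for the three powers
  have hlow : min r (min p l) < 1 → ∃ m > 0, ∀ z ∈ S, u₂ z.1 z.2 < u₁ z.1 z.2 →
      m ≤ u₁ z.1 z.2 := by
    intro hmin
    rcases S.eq_empty_or_nonempty with hemp | hne
    · exact ⟨1, one_pos, by simp [hemp]⟩
    rcases hpos hmin with h | h
    · obtain ⟨z, hz, hzmin⟩ := hS.exists_isMinOn hne hcS₁
      exact ⟨u₁ z.1 z.2, h _ (hSsub hz).1 _ (hSsub hz).2, fun w hw _ => hzmin hw⟩
    · obtain ⟨z, hz, hzmin⟩ := hS.exists_isMinOn hne hcS₂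
      exact ⟨u₂ z.1 z.2, h _ (hSsub hz).1 _ (hSsub hz).2, fun w hw hlt =>
        (show u₂ z.1 z.2 ≤ u₂ w.1 w.2 from hzmin hw).trans hlt.le⟩
  have hlip : ∀ e : ℝ, 0 < e → min r (min p l) ≤ e → ∃ L, 0 ≤ L ∧
      ∀ x ∈ closure Ω, ∀ t ∈ Icc 0 T', u₁ x t ^ e - u₂ x t ^ e ≤ L * max (u₁ x t - u₂ x t) 0 := by
    intro e he hmin
    obtain ⟨L, hL, h⟩ := exists_rpow_sub_rpow_le_mul_max (S := S) (u := fun z => u₁ z.1 z.2)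
      (v := fun z => u₂ z.1 z.2) he (fun z hz => hn₂ _ hz.1 _ (hIcc hz.2)) hM0 hu₁M
      (fun he1 => hlow (hmin.trans_lt he1))
    exact ⟨L, hL, fun x hx t ht => h (x, t) ⟨hx, ht⟩ (hn₁ x hx t (hIcc ht))⟩
  obtain ⟨Lr, hLr0, hLr⟩ := hlip r hr (min_le_left _ _)
  obtain ⟨Lp, hLp0, hLp⟩ := hlip p hp ((min_le_right _ _).trans (min_le_left _ _))
  obtain ⟨Ll, hLl0, hLl⟩ := hlip l hl ((min_le_right _ _).trans (min_le_right _ _))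
  -- the barrier
  obtain ⟨ψ, δ, hψ, hδ, hδψ, hψδ, hψ1, hψint⟩ := exists_boundary_layer_weight hΩ hb
    (η := 1 / (K * Ll + 1)) (by positivity)
  set J := ∫ y in Ω, ψ y with hJdef
  have hψ0 : ∀ y, 0 < ψ y := fun y => hδ.trans_le (hδψ y)
  have hJ0 : 0 ≤ J := integral_nonneg fun y => (hψ0 y).le
  have hKJ : K * Ll * J < 1 := by
    rw [lt_div_iff₀ (by positivity)] at hψint
    linarith
  obtain ⟨B, hB⟩ := (hb.isCompact_closure.image (continuous_lap hψ)).bddAbove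
  have hlapB : ∀ x ∈ closure Ω, lap ψ x ≤ B := fun x hx => hB (mem_image_of_mem _ hx)
  set V := volume.real Ω with hVdef
  have hV0 : 0 ≤ V := measureReal_nonneg
  set R := A * (Lr * (1 + δ) * (M ^ p * V) + M ^ r * (Lp * J)) with hRdef
  set lam := (|B| + R + 1) / δ with hlamdef
  have hR0 : 0 ≤ R := by positivity
  have hlam : |B| + R + 1 = lam * δ := by rw [hlamdef, div_mul_cancel₀ _ hδ.ne']
  have hlam0 : 0 ≤ lam := by positivity
  have hbarrier : ∀ ε > 0, u₁ x₁ t₁ - u₂ x₁ t₁ - ε * exp (lam * t₁) * ψ x₁ < 0 := by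
    intro ε hε
    have hE : ∀ t, 0 < ε * exp (lam * t) := fun t => by positivity
    have hEd : ∀ t, HasDerivAt (fun s => ε * exp (lam * s)) (ε * exp (lam * t) * lam) t := by
      intro t
      have := (((hasDerivAt_id t).const_mul lam).exp).const_mul ε
      simpa [mul_assoc] using this
    have hspace : ∀ {u : EuclideanSpace ℝ (Fin n) → ℝ → ℝ},
        (∀ t ∈ Ioo (0 : ℝ) T, ContDiffOn ℝ 2 (fun x => u x t) Ω) →
        ∀ x ∈ Ω, ∀ t ∈ Ioc 0 T', ContDiffAt ℝ 2 (fun y => u y t) x := fun hu x hx t ht =>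
      (hu t (hIoc ht)).contDiffAt (hΩ.mem_nhds hx)
    have hderiv : ∀ x ∈ Ω, ∀ t ∈ Ioc 0 T',
        HasDerivAt (fun s => u₁ x s - u₂ x s - ε * exp (lam * s) * ψ x)
          (deriv (u₁ x) t - deriv (u₂ x) t - ε * exp (lam * t) * lam * ψ x) t := fun x hx t ht =>
      ((hd₁ x hx t (hIoc ht)).hasDerivAt.sub (hd₂ x hx t (hIoc ht)).hasDerivAt).sub
        ((hEd t).mul_const _)
    refine neg_of_strict_parabolic (T := T') hΩ hb
      (g := fun x t => u₁ x t - u₂ x t - ε * exp (lam * t) * ψ x) ?_ ?_ ?_ ?_ ?_ ?_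
      x₁ hx₁ t₁ ⟨ht₁.1, hT₁.le⟩
    · have hψc := hψ.continuous
      exact (hcS₁.sub hcS₂).sub (by fun_prop)
    · intro x hx t ht
      exact ((hspace hC₁ x hx t ht).sub (hspace hC₂ x hx t ht)).sub
        (contDiffAt_const.mul hψ.contDiffAt)
    · exact fun x hx t ht => (hderiv x hx t ht).differentiableAt
    · intro x hx
      have := mul_pos (hE 0) (hψ0 x)
      have := hinit0 x hx
      linarith
    · intro x hx t ht hzero hle
      have htI : t ∈ Icc 0 T' := ⟨ht.1.le, ht.2⟩
      have hxc := subset_closure hx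
      set E := ε * exp (lam * t) with hEdef
      have hE0 : 0 < E := hE t
      rw [(hderiv x hx t ht).deriv,
        lap_sub ((hspace hC₁ x hx t ht).sub (hspace hC₂ x hx t ht))
          (contDiffAt_const.mul hψ.contDiffAt),
        lap_sub (hspace hC₁ x hx t ht) (hspace hC₂ x hx t ht), lap_const_mul hψ.contDiffAt]
      have hp1 := hpde₁ x hx t (hIoc ht)
      have hp2 := hpde₂ x hx t (hIoc ht)
      have hw : u₁ x t - u₂ x t = E * ψ x := by linarith
      have hEψ : 0 < E * ψ x := mul_pos hE0 (hψ0 x)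
      have hab' := hab x hxc t ht.1.le
      have hqle : b x t * u₂ x t ^ q ≤ b x t * u₁ x t ^ q :=
        mul_le_mul_of_nonneg_left
          (Real.rpow_le_rpow (hn₂ x hxc t (hIcc htI)) (by linarith) hq.le) hab'.2
      set I₁ := ∫ y in Ω, u₁ y t ^ p with hI₁
      set I₂ := ∫ y in Ω, u₂ y t ^ p with hI₂
      have hI : I₁ - I₂ ≤ Lp * (E * J) := by
        have := setIntegral_mul_rpow_sub_le hΩ hb (c := fun _ => 1) (u := fun y => u₁ y t)
          (v := fun y => u₂ y t) (φ := fun y => E * ψ y) (C := 1) hp hLp0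
          continuousOn_const (hslice hcS₁ t htI) (hslice hcS₂ t htI)
          (continuous_const.mul hψ.continuous).continuousOn
          (fun y _ => (mul_pos hE0 (hψ0 y)).le) (fun _ _ => zero_le_one) (fun _ _ => le_rfl)
          (fun y hy => hLp y (subset_closure hy) t htI)
          (fun y hy => by linarith [hle y (subset_closure hy)])
        simpa only [one_mul, integral_const_mul] using this
      have hI₁0 : 0 ≤ I₁ := setIntegral_nonneg hΩ.measurableSet fun y hy =>
        Real.rpow_nonneg (hn₁ y (subset_closure hy) t (hIcc htI)) p
      have hI₁V : I₁ ≤ M ^ p * V := by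
        have hle' : I₁ ≤ ∫ _ in Ω, M ^ p := by
          refine setIntegral_mono_on ?_ (integrableOn_const hb.measure_lt_top.ne)
            hΩ.measurableSet fun y hy => ?_
          · exact (((hslice hcS₁ t htI).rpow_const fun _ _ => Or.inr hp.le).integrableOn_compact
              hb.isCompact_closure).mono_set subset_closure
          · exact Real.rpow_le_rpow (hn₁ y (subset_closure hy) t (hIcc htI))
              (hu₁M (y, t) ⟨subset_closure hy, htI⟩) hp.le
        rwa [setIntegral_const, smul_eq_mul, mul_comm] at hle'
      have hr1 : u₁ x t ^ r - u₂ x t ^ r ≤ Lr * (E * (1 + δ)) := by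
        refine (hLr x hxc t htI).trans (mul_le_mul_of_nonneg_left ?_ hLr0)
        rw [hw, max_eq_left hEψ.le]
        exact mul_le_mul_of_nonneg_left (hψδ x) hE0.le
      have hr2 : u₂ x t ^ r ≤ M ^ r := Real.rpow_le_rpow (hn₂ x hxc t (hIcc htI))
        (hu₂M (x, t) ⟨hxc, htI⟩) hr.le
      have hr20 : 0 ≤ u₂ x t ^ r := Real.rpow_nonneg (hn₂ x hxc t (hIcc htI)) r
      have hreact : u₁ x t ^ r * I₁ - u₂ x t ^ r * I₂ ≤
          E * (Lr * (1 + δ) * (M ^ p * V) + M ^ r * (Lp * J)) := by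
        have e1 : (u₁ x t ^ r - u₂ x t ^ r) * I₁ ≤ Lr * (E * (1 + δ)) * (M ^ p * V) :=
          mul_le_mul hr1 hI₁V hI₁0 (by positivity)
        have e2 : u₂ x t ^ r * (I₁ - I₂) ≤ M ^ r * (Lp * (E * J)) :=
          (mul_le_mul_of_nonneg_left hI hr20).trans
            (mul_le_mul_of_nonneg_right hr2 (by positivity))
        linarith
      have hreactA : a x t * (u₁ x t ^ r * I₁ - u₂ x t ^ r * I₂) ≤ E * R := by
        have e1 := mul_le_mul_of_nonneg_left hreact hab'.1
        have e2 := mul_le_mul_of_nonneg_right (hA x hxc t htI)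
          (show 0 ≤ E * (Lr * (1 + δ) * (M ^ p * V) + M ^ r * (Lp * J)) by positivity)
        rw [hRdef]
        linarith
      have hlapE : E * lap ψ x ≤ E * |B| :=
        mul_le_mul_of_nonneg_left ((hlapB x hxc).trans (le_abs_self B)) hE0.le
      have hgrow : E * (|B| + R + 1) ≤ E * lam * ψ x := by
        rw [hlam, mul_assoc E]
        exact mul_le_mul_of_nonneg_left (mul_le_mul_of_nonneg_left (hδψ x) hlam0) hE0.le
      linarith
    · intro x hx t ht hle hzero
      have htI : t ∈ Icc 0 T' := ⟨ht.1.le, ht.2⟩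
      set E := ε * exp (lam * t) with hEdef
      have hE0 : 0 < E := hE t
      have h1 := hbc₁ x hx t (hIoc ht)
      have h2 := hbc₂ x hx t (hIoc ht)
      have hI := setIntegral_mul_rpow_sub_le hΩ hb (c := fun y => k x y t)
        (u := fun y => u₁ y t) (v := fun y => u₂ y t) (φ := fun y => E * ψ y) hl hLl0
        (hk.comp (f := fun y => ((x, y), t)) (by fun_prop) fun y hy => ⟨⟨hx, hy⟩, ht.1.le⟩)
        (hslice hcS₁ t htI) (hslice hcS₂ t htI)
        (continuous_const.mul hψ.continuous).continuousOn
        (fun y _ => (mul_pos hE0 (hψ0 y)).le)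
        (fun y hy => hk0 x hx y (subset_closure hy) t ht.1.le)
        (fun y hy => hkK x hx y (subset_closure hy) t htI)
        (fun y hy => hLl y (subset_closure hy) t htI)
        (fun y hy => by linarith [hle y (subset_closure hy)])
      rw [integral_const_mul] at hI
      have hxΩ : x ∉ Ω := by
        rw [hΩ.frontier_eq] at hx
        exact hx.2
      have h3 : E * 1 ≤ E * ψ x := mul_le_mul_of_nonneg_left (hψ1 x hxΩ) hE0.le
      have h4 : E * (K * Ll * J) < E * 1 := mul_lt_mul_of_pos_left hKJ hE0
      linarith
  refine le_of_forall_pos_lt_add fun ε hε => ?_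
  have hc : 0 < exp (lam * t₁) * ψ x₁ := mul_pos (exp_pos _) (hψ0 x₁)
  have := hbarrier (ε / (exp (lam * t₁) * ψ x₁)) (by positivity)
  rw [mul_assoc, div_mul_cancel₀ _ hc.ne'] at this
  linarith
end
end

section
/- Explicit global solution showing sharpness of the decay rate of b: Let q > 1 and σ > 0, and set μ = λ₁ + σ/(q−1). Define a(x,t) = [(λ₁(q−1)+σ)/((q−1)|Ω|)] exp[(r+p−1)μ t], b(x,t) = 2μ exp[(λ₁(q−1)+σ)t], and k(x,y,t) = |Ω|⁻¹ exp[(l−1)μ t]. Then the function u(x,t) = e^{−μ t} is a global solution of problem (P) with initial datum u₀ ≡ 1; in particular it satisfies u_t = Δu + a(x,t)u^r ∫_Ω u^p(y,t) dy − b(x,t)u^q in Ω × (0,∞) and u(x,t) = ∫_Ω k(x,y,t)u^l(y,t) dy on ∂Ω × (0,∞). -/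
open Set MeasureTheory Real Filter

noncomputable section

theorem lap_const {n : ℕ} (c : ℝ) (x : EuclideanSpace ℝ (Fin n)) :
    lap (fun _ => c) x = 0 := by
  simp [lap]

/-- **Explicit global solution showing sharpness of the decay rate of `b`.** Let `q > 1`,
`σ > 0`, `μ = λ₁ + σ/(q−1)`, and take
`a(x,t) = [(λ₁(q−1)+σ)/((q−1)|Ω|)] exp[(r+p−1)μt]`,
`b(x,t) = 2μ exp[(λ₁(q−1)+σ)t]`, `k(x,y,t) = |Ω|⁻¹ exp[(l−1)μt]`. Then
`u(x,t) = e^{−μt}` is a global solution of problem (P) with `u₀ ≡ 1`. -/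
theorem explicit_global_solution {n : ℕ} (r p q l : ℝ)
    (hr : 0 < r) (hp : 0 < p) (hl : 0 < l) (hq : 1 < q)
    (Ω : Set (EuclideanSpace ℝ (Fin n)))
    (a b : EuclideanSpace ℝ (Fin n) → ℝ → ℝ)
    (k : EuclideanSpace ℝ (Fin n) → EuclideanSpace ℝ (Fin n) → ℝ → ℝ)
    (hdata : GoodData Ω a b k)
    (lam : ℝ) (φ : EuclideanSpace ℝ (Fin n) → ℝ) (heig : IsFirstEigen Ω lam φ)
    (σ : ℝ) (hσ : 0 < σ)
    (ha : ∀ x t, a x t = (lam * (q - 1) + σ) / ((q - 1) * (volume Ω).toReal) *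
      Real.exp ((r + p - 1) * (lam + σ / (q - 1)) * t))
    (hb : ∀ x t, b x t = 2 * (lam + σ / (q - 1)) * Real.exp ((lam * (q - 1) + σ) * t))
    (hk : ∀ x y t, k x y t = ((volume Ω).toReal)⁻¹ *
      Real.exp ((l - 1) * (lam + σ / (q - 1)) * t)) :
    ∀ T : ℝ, 0 < T → IsSol r p q l Ω a b k (fun _ => (1:ℝ)) T
      (fun _ t => Real.exp (-(lam + σ / (q - 1)) * t)) := by
  have hq1 : q - 1 ≠ 0 := by linarith
  obtain ⟨hopen, hbdd, hne, -⟩ := hdata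
  have hV : (volume Ω).toReal ≠ 0 :=
    (ENNReal.toReal_pos (hopen.measure_pos volume hne).ne' hbdd.measure_lt_top.ne).ne'
  intro T _
  have hreg : RegQ Ω T (fun _ t => Real.exp (-(lam + σ / (q - 1)) * t)) :=
    ⟨by fun_prop, fun t _ => contDiffOn_const, fun x _ t _ => by fun_prop⟩
  have hexp : ∀ c d e : ℝ, c + d = e → Real.exp c * Real.exp d = Real.exp e :=
    fun c d e h => by rw [← Real.exp_add, h]
  set μ := lam + σ / (q - 1) with hμ
  have hσ' : lam * (q - 1) + σ = μ * (q - 1) := by rw [hμ]; field_simp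
  have hpde : ∀ x ∈ Ω, ∀ t ∈ Ioo (0:ℝ) T,
      deriv (fun s => Real.exp (-μ * s)) t
        = lap (fun _ : EuclideanSpace ℝ (Fin n) => Real.exp (-μ * t)) x
          + a x t * Real.exp (-μ * t) ^ r * (∫ _ in Ω, Real.exp (-μ * t) ^ p)
          - b x t * Real.exp (-μ * t) ^ q := by
    intro x _ t _
    have hderiv : deriv (fun s => Real.exp (-μ * s)) t = Real.exp (-μ * t) * (-μ) := by
      simpa using (((hasDerivAt_id t).const_mul (-μ)).exp).deriv
    have hA : Real.exp ((r + p - 1) * μ * t) * Real.exp (-μ * t * r) * Real.exp (-μ * t * p)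
        = Real.exp (-μ * t) := by
      rw [← Real.exp_add, ← Real.exp_add]
      ring_nf
    have hB : Real.exp (μ * (q - 1) * t) * Real.exp (-μ * t * q) = Real.exp (-μ * t) :=
      hexp _ _ _ (by ring)
    rw [hderiv, lap_const, ha, hb, hσ', setIntegral_const, smul_eq_mul, measureReal_def,
      ← Real.exp_mul, ← Real.exp_mul, ← Real.exp_mul]
    have hcoef : μ * (q - 1) / ((q - 1) * (volume Ω).toReal) * (volume Ω).toReal = μ := by
      field_simp
    linear_combination (-μ) * hA + 2 * μ * hB
      - Real.exp ((r + p - 1) * μ * t) * Real.exp (-μ * t * r) * Real.exp (-μ * t * p) * hcoef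
  have hbdry : ∀ x ∈ frontier Ω, ∀ t ∈ Ioo (0:ℝ) T,
      Real.exp (-μ * t) = ∫ y in Ω, k x y t * Real.exp (-μ * t) ^ l := by
    intro x _ t _
    simp only [hk]
    rw [setIntegral_const, smul_eq_mul, measureReal_def, ← Real.exp_mul, ← mul_assoc,
      ← mul_assoc, mul_inv_cancel₀ hV, one_mul]
    exact (hexp _ _ _ (by ring)).symm
  exact ⟨⟨hreg, fun _ _ _ _ => (Real.exp_pos _).le, fun x hx t ht => (hpde x hx t ht).le,
      fun x hx t ht => (hbdry x hx t ht).le, fun _ _ => by simp⟩,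
    ⟨hreg, fun _ _ _ _ => (Real.exp_pos _).le, fun x hx t ht => (hpde x hx t ht).ge,
      fun x hx t ht => (hbdry x hx t ht).ge, fun _ _ => by simp⟩⟩
end
end
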